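/- arXiv:math/0609374 — 2 statements merged into one kernel-verified Lean document; each statement's English description precedes it below -/
import Mathlib

section
/- Let c₁, c₂, c₃ > 0 and let E = {x ∈ ℝ³ : x₁²/c₁² + x₂²/c₂² + x₃²/c₃² < 1}. For j = 1,2,3 define a_j = (c₁c₂c₃/2) ∫₀^∞ ds / ((c_j² + s)·√((c₁² + s)(c₂² + s)(c₃² + s))). Then there exists a constant C ∈ ℝ such that for every x ∈ E, N_E(x) = C - (1/2)(a₁ x₁² + a₂ x₂² + a₃ x₃²). -/
open MeasureTheory

noncomputable section

abbrev Euc (d : ℕ) := EuclideanSpace ℝ (Fin d)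

/-- The Newtonian potential of a bounded measurable set `D ⊂ ℝ³`. -/
def newtonPot (D : Set (Euc 3)) (x : Euc 3) : ℝ :=
  (1 / (4 * Real.pi)) * ∫ y in D, ‖x - y‖⁻¹

open Set Filter Topology

/-- Integration in polar coordinates for nonnegative functions. -/
theorem lintegral_eq_lintegral_toSphere_Ioi {E : Type*} [NormedAddCommGroup E] [NormedSpace ℝ E]
    [FiniteDimensional ℝ E] [Nontrivial E] [MeasurableSpace E] [BorelSpace E]
    (μ : Measure E) [μ.IsAddHaarMeasure] {f : E → ENNReal} (hf : Measurable f) :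
    ∫⁻ x, f x ∂μ = ∫⁻ ω : Metric.sphere (0 : E) 1, (∫⁻ r in Ioi (0 : ℝ),
      ENNReal.ofReal (r ^ (Module.finrank ℝ E - 1)) * f (r • (ω : E))) ∂μ.toSphere := by
  have hmp := μ.measurePreserving_homeomorphUnitSphereProd.symm
    (homeomorphUnitSphereProd E).toMeasurableEquiv
  calc ∫⁻ x, f x ∂μ = ∫⁻ x : ({(0)}ᶜ : Set E), f x ∂(μ.comap (↑)) := by
        rw [lintegral_subtype_comap (measurableSet_singleton _).compl f, restrict_compl_singleton]
    _ = ∫⁻ p, f (p.2.1 • p.1.1)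
          ∂(μ.toSphere.prod (Measure.volumeIoiPow (Module.finrank ℝ E - 1))) := by
        rw [← hmp.lintegral_comp_emb (MeasurableEquiv.measurableEmbedding _)]
        rfl
    _ = _ := by
        rw [lintegral_prod _ (by fun_prop)]
        refine lintegral_congr fun ω => ?_
        rw [Measure.volumeIoiPow, lintegral_withDensity_eq_lintegral_mul _ (by fun_prop)
          (by fun_prop)]
        exact lintegral_subtype_comap measurableSet_Ioi fun r : ℝ =>
          ENNReal.ofReal (r ^ (Module.finrank ℝ E - 1)) * f (r • (ω : E))

theorem setLIntegral_Ioo_ofReal_id {R : ℝ} (hR : 0 ≤ R) :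
    ∫⁻ r in Ioo 0 R, ENNReal.ofReal r = ENNReal.ofReal (R ^ 2 / 2) := by
  rw [Measure.restrict_congr_set Ioo_ae_eq_Ioc, ← ofReal_integral_eq_lintegral_ofReal,
    ← intervalIntegral.integral_of_le hR]
  · simp
  · exact (intervalIntegral.intervalIntegrable_id (μ := volume)).1
  · filter_upwards [ae_restrict_mem measurableSet_Ioc] with y hy using hy.1.le

theorem tendsto_sq_mul_exp_neg_mul_sq {A : ℝ} (hA : 0 < A) (α β : ℝ) :
    Tendsto (fun r : ℝ => -((α + β * r ^ 2) * Real.exp (-A * r ^ 2))) atTop (𝓝 0) := by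
  have h1 : Tendsto (fun r : ℝ => A * r ^ 2) atTop atTop :=
    (tendsto_pow_atTop two_ne_zero).const_mul_atTop hA
  have h2 := (Real.tendsto_pow_mul_exp_neg_atTop_nhds_zero 0).comp h1
  have h3 := (Real.tendsto_pow_mul_exp_neg_atTop_nhds_zero 1).comp h1
  have h4 := ((h2.const_mul α).add (h3.const_mul (β / A))).neg
  simp only [mul_zero, add_zero, neg_zero] at h4
  refine h4.congr fun r => ?_
  simp only [Function.comp]
  field_simp

theorem setLIntegral_Ioi_mul_add_sq_mul_exp {A B K : ℝ} (hA : 0 < A) (hK : 0 < K) :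
    ∫⁻ r in Ioi (0 : ℝ), ENNReal.ofReal
        (r * (2 * (K + 2 * (B * r) ^ 2) * Real.exp (-A * r ^ 2))) =
      ENNReal.ofReal (K / A + 2 * B ^ 2 / A ^ 2) := by
  set α := K / A + 2 * B ^ 2 / A ^ 2
  set β := 2 * B ^ 2 / A
  have hderiv : ∀ r ∈ Ioi (0 : ℝ), HasDerivAt
      (fun r : ℝ => -((α + β * r ^ 2) * Real.exp (-A * r ^ 2)))
      (r * (2 * (K + 2 * (B * r) ^ 2) * Real.exp (-A * r ^ 2))) r := by
    intro r _
    have h1 : HasDerivAt (fun r : ℝ => α + β * r ^ 2) (β * (2 * r)) r := by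
      simpa using ((hasDerivAt_pow 2 r).const_mul β).const_add α
    have h2 : HasDerivAt (fun r : ℝ => -A * r ^ 2) (-A * (2 * r)) r := by
      simpa using (hasDerivAt_pow 2 r).const_mul (-A)
    refine (h1.mul h2.exp).neg.congr_deriv ?_
    simp only [α, β]
    field_simp
    ring
  have hcont : ContinuousWithinAt
      (fun r : ℝ => -((α + β * r ^ 2) * Real.exp (-A * r ^ 2))) (Ici 0) 0 := by
    apply Continuous.continuousWithinAt
    fun_prop
  have hnn : ∀ r ∈ Ioi (0 : ℝ), 0 ≤ r * (2 * (K + 2 * (B * r) ^ 2) * Real.exp (-A * r ^ 2)) := by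
    intro r hr
    have : 0 < r := hr
    positivity
  have hlim := tendsto_sq_mul_exp_neg_mul_sq hA α β
  rw [← ofReal_integral_eq_lintegral_ofReal
    (integrableOn_Ioi_deriv_of_nonneg hcont hderiv hnn hlim)
    ((ae_restrict_iff' measurableSet_Ioi).2 (ae_of_all _ hnn)),
    integral_Ioi_of_hasDerivAt_of_nonneg hcont hderiv hnn hlim]
  simp

/-- The part of a ray lying in a sublevel set of a quadratic form is an interval. -/
theorem Ioi_inter_quadratic_lt {A B K : ℝ} (hA : 0 < A) (hK : 0 < K) :
    {r : ℝ | A * r ^ 2 + 2 * B * r < K} ∩ Ioi 0 =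
      Ioo 0 ((-B + √(B ^ 2 + A * K)) / A) := by
  have hD : 0 ≤ B ^ 2 + A * K := by positivity
  set s := √(B ^ 2 + A * K) with hs
  have hs2 : s ^ 2 = B ^ 2 + A * K := Real.sq_sqrt hD
  have hsB : |B| < s := by
    rw [hs, ← Real.sqrt_sq_eq_abs]
    exact Real.sqrt_lt_sqrt (sq_nonneg _) (by nlinarith [mul_pos hA hK])
  obtain ⟨hB1, hB2⟩ := abs_lt.1 hsB
  ext r
  simp only [mem_inter_iff, mem_ofPred_eq, mem_Ioi, mem_Ioo, lt_div_iff₀ hA]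
  constructor
  · rintro ⟨h, hr⟩
    refine ⟨hr, ?_⟩
    have : |r * A + B| < s := by
      apply abs_lt_of_sq_lt_sq _ (by linarith [abs_nonneg B])
      nlinarith
    linarith [(abs_lt.1 this).2]
  · rintro ⟨hr, h⟩
    refine ⟨?_, hr⟩
    have hrA := mul_pos hr hA
    have : (r * A + B) ^ 2 < s ^ 2 := sq_lt_sq' (by linarith) (by linarith)
    have h2 : A * (A * r ^ 2 + 2 * B * r) < A * K := by nlinarith
    exact lt_of_mul_lt_mul_left h2 hA.le

theorem setLIntegral_Ioi_indicator_quadratic_lt {A B K : ℝ} (hA : 0 < A) (hK : 0 < K) :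
    ∫⁻ r in Ioi (0 : ℝ), {r : ℝ | A * r ^ 2 + 2 * B * r < K}.indicator ENNReal.ofReal r =
      ENNReal.ofReal (((-B + √(B ^ 2 + A * K)) / A) ^ 2 / 2) := by
  have hm : MeasurableSet {r : ℝ | A * r ^ 2 + 2 * B * r < K} :=
    measurableSet_lt (by fun_prop) (by fun_prop)
  rw [setLIntegral_indicator hm, Ioi_inter_quadratic_lt hA hK, setLIntegral_Ioo_ofReal_id]
  have : |B| ≤ √(B ^ 2 + A * K) := by
    rw [← Real.sqrt_sq_eq_abs]
    exact Real.sqrt_le_sqrt (by nlinarith [mul_pos hA hK])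
  have := le_abs_self B
  apply div_nonneg _ hA.le
  linarith

theorem setLIntegral_Ioi_indicator_add_indicator {A B K : ℝ} (hA : 0 < A) (hK : 0 < K) :
    ∫⁻ r in Ioi (0 : ℝ), ({r : ℝ | A * r ^ 2 + 2 * B * r < K}.indicator ENNReal.ofReal r +
        {r : ℝ | A * r ^ 2 + 2 * (-B) * r < K}.indicator ENNReal.ofReal r) =
      ∫⁻ r in Ioi (0 : ℝ), ENNReal.ofReal
        (r * (2 * (K + 2 * (B * r) ^ 2) * Real.exp (-A * r ^ 2))) := by
  have hm : MeasurableSet {r : ℝ | A * r ^ 2 + 2 * B * r < K} :=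
    measurableSet_lt (by fun_prop) (by fun_prop)
  rw [lintegral_add_left (ENNReal.measurable_ofReal.indicator hm),
    setLIntegral_Ioi_indicator_quadratic_lt hA hK, setLIntegral_Ioi_indicator_quadratic_lt hA hK,
    setLIntegral_Ioi_mul_add_sq_mul_exp hA hK, ← ENNReal.ofReal_add (by positivity) (by positivity)]
  congr 1
  have hs2 : √(B ^ 2 + A * K) ^ 2 = B ^ 2 + A * K := Real.sq_sqrt (by positivity)
  rw [neg_sq]
  field_simp
  linear_combination 2 * hs2

theorem sum_mul_sq_pos {n : ℕ} {b : Fin n → ℝ} (hb : ∀ j, 0 < b j) {z : Euc n} (hz : z ≠ 0) :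
    0 < ∑ j, b j * z j ^ 2 := by
  obtain ⟨i, hi⟩ : ∃ i, z i ≠ 0 := by
    by_contra! h
    exact hz (by ext i; simpa using h i)
  exact Finset.sum_pos' (fun j _ => mul_nonneg (hb j).le (sq_nonneg _))
    ⟨i, Finset.mem_univ i, mul_pos (hb i) (by positivity)⟩

theorem measurableSet_sum_mul_sq_lt {n : ℕ} (b : Fin n → ℝ) :
    MeasurableSet {y : Euc n | ∑ j, b j * y j ^ 2 < 1} :=
  measurableSet_lt (by fun_prop) (by fun_prop)

/-- The two translates of an ellipsoid by `±x`, taken together, have the same weighted mass along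
each ray from the origin as a Gaussian times a quadratic polynomial. -/
theorem lintegral_indicator_translates_div_norm {b : Fin 3 → ℝ} (hb : ∀ j, 0 < b j) {x : Euc 3}
    (hx : ∑ j, b j * x j ^ 2 < 1) :
    ∫⁻ z : Euc 3, ({y : Euc 3 | ∑ j, b j * y j ^ 2 < 1}.indicator 1 (x + z) +
        {y : Euc 3 | ∑ j, b j * y j ^ 2 < 1}.indicator 1 (x - z)) * ENNReal.ofReal ‖z‖⁻¹ =
      ∫⁻ z : Euc 3, ENNReal.ofReal (2 * ((1 - ∑ j, b j * x j ^ 2) +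
        2 * (∑ j, b j * x j * z j) ^ 2) * Real.exp (-∑ j, b j * z j ^ 2) * ‖z‖⁻¹) := by
  have hE := measurableSet_sum_mul_sq_lt b
  have hI : Measurable ({y : Euc 3 | ∑ j, b j * y j ^ 2 < 1}.indicator (1 : Euc 3 → ENNReal)) :=
    measurable_one.indicator hE
  refine (lintegral_eq_lintegral_toSphere_Ioi _ (by fun_prop)).trans
    (Eq.trans ?_ (lintegral_eq_lintegral_toSphere_Ioi _ (by fun_prop)).symm)
  refine lintegral_congr fun ω => ?_
  have hω : ‖(ω : Euc 3)‖ = 1 := by simp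
  have hω0 : (ω : Euc 3) ≠ 0 := by
    rintro h
    simp [h] at hω
  generalize (ω : Euc 3) = w at hω hω0
  have hA := sum_mul_sq_pos hb hω0
  set A := ∑ j, b j * w j ^ 2 with hAdef
  set B := ∑ j, b j * x j * w j with hBdef
  set K := 1 - ∑ j, b j * x j ^ 2 with hKdef
  have hK : 0 < K := by linarith
  have hplus : ∀ r : ℝ, x + r • w ∈ {y : Euc 3 | ∑ j, b j * y j ^ 2 < 1} ↔
      r ∈ {r : ℝ | A * r ^ 2 + 2 * B * r < K} := by
    intro r
    simp only [mem_ofPred_eq, hAdef, hBdef, hKdef, Fin.sum_univ_three, PiLp.add_apply,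
      PiLp.smul_apply, smul_eq_mul]
    constructor <;> intro h <;> linarith
  have hminus : ∀ r : ℝ, x - r • w ∈ {y : Euc 3 | ∑ j, b j * y j ^ 2 < 1} ↔
      r ∈ {r : ℝ | A * r ^ 2 + 2 * (-B) * r < K} := by
    intro r
    simp only [mem_ofPred_eq, hAdef, hBdef, hKdef, Fin.sum_univ_three, PiLp.sub_apply,
      PiLp.smul_apply, smul_eq_mul]
    constructor <;> intro h <;> linarith
  have hrank : Module.finrank ℝ (Euc 3) - 1 = 2 := by simp
  rw [hrank]
  refine Eq.trans ?_ ((setLIntegral_Ioi_indicator_add_indicator (B := B) hA hK).trans ?_)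
  · refine setLIntegral_congr_fun measurableSet_Ioi fun r hr => ?_
    have hr : 0 < r := hr
    have hnorm : ‖r • w‖ = r := by rw [norm_smul, hω, mul_one, Real.norm_of_nonneg hr.le]
    have hrr : ENNReal.ofReal (r ^ 2) * ENNReal.ofReal r⁻¹ = ENNReal.ofReal r := by
      rw [← ENNReal.ofReal_mul (by positivity)]
      congr 1
      field_simp
    have hind : ∀ (y : Euc 3) (s : Set ℝ), (y ∈ {y : Euc 3 | ∑ j, b j * y j ^ 2 < 1} ↔ r ∈ s) →
        {y : Euc 3 | ∑ j, b j * y j ^ 2 < 1}.indicator (1 : Euc 3 → ENNReal) y *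
          ENNReal.ofReal r = s.indicator ENNReal.ofReal r := by
      intro y s hys
      by_cases hrs : r ∈ s
      · rw [indicator_of_mem hrs, indicator_of_mem (hys.2 hrs), Pi.one_apply, one_mul]
      · rw [indicator_of_notMem hrs, indicator_of_notMem (mt hys.1 hrs), zero_mul]
    simp only [hnorm]
    rw [mul_left_comm, hrr, add_mul, hind _ _ (hplus r), hind _ _ (hminus r)]
  · refine setLIntegral_congr_fun measurableSet_Ioi fun r hr => ?_
    have hr : 0 < r := hr
    have hnorm : ‖r • w‖ = r := by rw [norm_smul, hω, mul_one, Real.norm_of_nonneg hr.le]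
    simp only [hnorm]
    rw [← ENNReal.ofReal_mul (by positivity)]
    have h1 : ∑ j, b j * x j * (r • w) j = B * r := by
      simp only [hBdef, Fin.sum_univ_three, PiLp.smul_apply, smul_eq_mul]
      ring
    have h2 : -∑ j, b j * (r • w) j ^ 2 = -A * r ^ 2 := by
      simp only [hAdef, Fin.sum_univ_three, PiLp.smul_apply, smul_eq_mul]
      ring
    rw [h1, h2]
    congr 1
    field_simp

theorem lintegral_ellipsoid_inv_norm_sub {b : Fin 3 → ℝ} (hb : ∀ j, 0 < b j) {x : Euc 3}
    (hx : ∑ j, b j * x j ^ 2 < 1) :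
    ∫⁻ y in {y : Euc 3 | ∑ j, b j * y j ^ 2 < 1}, ENNReal.ofReal ‖x - y‖⁻¹ =
      ∫⁻ z : Euc 3, ENNReal.ofReal (((1 - ∑ j, b j * x j ^ 2) +
        2 * (∑ j, b j * x j * z j) ^ 2) * Real.exp (-∑ j, b j * z j ^ 2) * ‖z‖⁻¹) := by
  have hsymm := lintegral_indicator_translates_div_norm hb hx
  have hE := measurableSet_sum_mul_sq_lt b
  set E := {y : Euc 3 | ∑ j, b j * y j ^ 2 < 1}
  have hI : Measurable (E.indicator (1 : Euc 3 → ENNReal)) := measurable_one.indicator hE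
  have h0 : ∫⁻ y in E, ENNReal.ofReal ‖x - y‖⁻¹ =
      ∫⁻ y, E.indicator 1 y * ENNReal.ofReal ‖x - y‖⁻¹ := by
    rw [← lintegral_indicator hE]
    refine lintegral_congr fun y => ?_
    by_cases hy : y ∈ E <;> simp [hy]
  have hp : ∫⁻ y, E.indicator 1 y * ENNReal.ofReal ‖x - y‖⁻¹ =
      ∫⁻ z, E.indicator 1 (x + z) * ENNReal.ofReal ‖z‖⁻¹ := by
    rw [← lintegral_add_left_eq_self _ x]
    simp
  have hm : ∫⁻ y, E.indicator 1 y * ENNReal.ofReal ‖x - y‖⁻¹ =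
      ∫⁻ z, E.indicator 1 (x - z) * ENNReal.ofReal ‖z‖⁻¹ := by
    rw [← lintegral_sub_left_eq_self _ x]
    simp
  simp only [add_mul] at hsymm
  rw [lintegral_add_left (by fun_prop), ← hp, ← hm, ← two_mul] at hsymm
  rw [h0]
  have h2 : (2 : ENNReal) ≠ 0 := two_ne_zero
  refine (ENNReal.mul_right_inj h2 ENNReal.ofNat_ne_top).1 (hsymm.trans ?_)
  rw [← lintegral_const_mul _ (by fun_prop)]
  refine lintegral_congr fun z => ?_
  have key : ∀ t : ℝ, 2 * ENNReal.ofReal t = ENNReal.ofReal (2 * t) := by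
    intro t
    rw [ENNReal.ofReal_mul (by norm_num), ENNReal.ofReal_ofNat]
  rw [key]
  congr 1
  ring

theorem integral_ellipsoid_inv_norm_sub {b : Fin 3 → ℝ} (hb : ∀ j, 0 < b j) {x : Euc 3}
    (hx : ∑ j, b j * x j ^ 2 < 1) :
    ∫ y in {y : Euc 3 | ∑ j, b j * y j ^ 2 < 1}, ‖x - y‖⁻¹ =
      ∫ z : Euc 3, ((1 - ∑ j, b j * x j ^ 2) + 2 * (∑ j, b j * x j * z j) ^ 2) *
        Real.exp (-∑ j, b j * z j ^ 2) * ‖z‖⁻¹ := by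
  rw [integral_eq_lintegral_of_nonneg_ae (ae_of_all _ fun y => by positivity)
    (by fun_prop : Measurable _).aestronglyMeasurable, lintegral_ellipsoid_inv_norm_sub hb hx,
    integral_eq_lintegral_of_nonneg_ae _ (by fun_prop : Measurable _).aestronglyMeasurable]
  refine ae_of_all _ fun z => ?_
  have : 0 < 1 - ∑ j, b j * x j ^ 2 := by linarith
  simp only [Pi.zero_apply]
  positivity

theorem exists_pos_mul_norm_sq_le {b : Fin 3 → ℝ} (hb : ∀ j, 0 < b j) :
    ∃ β > 0, ∀ z : Euc 3, β * ‖z‖ ^ 2 ≤ ∑ j, b j * z j ^ 2 := by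
  refine ⟨min (b 0) (min (b 1) (b 2)), lt_min (hb 0) (lt_min (hb 1) (hb 2)), fun z => ?_⟩
  rw [EuclideanSpace.real_norm_sq_eq, Finset.mul_sum]
  refine Finset.sum_le_sum fun j _ => mul_le_mul_of_nonneg_right ?_ (sq_nonneg _)
  fin_cases j <;> simp

theorem integrable_mul_exp_neg_mul_inv_norm {b : Fin 3 → ℝ} (hb : ∀ j, 0 < b j) {f : Euc 3 → ℝ}
    (hf : Measurable f) (k : ℕ) (hfk : ∀ z, |f z| ≤ ‖z‖ ^ k) :
    Integrable fun z : Euc 3 => f z * Real.exp (-∑ j, b j * z j ^ 2) * ‖z‖⁻¹ := by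
  obtain ⟨β, hβ, hle⟩ := exists_pos_mul_norm_sq_le hb
  have hrad : Integrable (fun z : Euc 3 =>
      (fun y : ℝ => y ^ k * Real.exp (-β * y ^ 2) * y⁻¹) ‖z‖) := by
    refine (integrable_fun_norm_addHaar volume
      (f := fun y : ℝ => y ^ k * Real.exp (-β * y ^ 2) * y⁻¹)).2 ?_
    refine (integrableOn_rpow_mul_exp_neg_mul_sq hβ
      (neg_one_lt_zero.trans_le (k + 1).cast_nonneg)).congr_fun (fun y hy => ?_) measurableSet_Ioi
    have hy : 0 < y := hy
    simp only [Real.rpow_natCast, finrank_euclideanSpace, Fintype.card_fin, smul_eq_mul]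
    norm_num
    field_simp
    ring
  refine hrad.mono' (by fun_prop : Measurable _).aestronglyMeasurable (ae_of_all _ fun z => ?_)
  rw [norm_mul, norm_mul, Real.norm_eq_abs, Real.norm_eq_abs, Real.abs_exp, norm_inv, norm_norm]
  change _ ≤ ‖z‖ ^ k * Real.exp (-β * ‖z‖ ^ 2) * ‖z‖⁻¹
  gcongr
  · exact hfk z
  · linarith [hle z]

theorem integrable_exp_neg_mul_inv_norm {b : Fin 3 → ℝ} (hb : ∀ j, 0 < b j) :
    Integrable fun z : Euc 3 => Real.exp (-∑ j, b j * z j ^ 2) * ‖z‖⁻¹ := by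
  simpa using integrable_mul_exp_neg_mul_inv_norm hb (f := fun _ => 1) (by fun_prop) 0 (by simp)

theorem integrable_coord_mul_coord_mul_exp {b : Fin 3 → ℝ} (hb : ∀ j, 0 < b j) (i j : Fin 3) :
    Integrable fun z : Euc 3 => z i * z j * Real.exp (-∑ j, b j * z j ^ 2) * ‖z‖⁻¹ := by
  refine integrable_mul_exp_neg_mul_inv_norm hb (by fun_prop) 2 fun z => ?_
  rw [abs_mul, sq]
  exact mul_le_mul (PiLp.norm_apply_le z i) (PiLp.norm_apply_le z j) (abs_nonneg _) (norm_nonneg _)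

/-- The reflection of `ℝ³` in the `i`-th coordinate hyperplane. -/
def coordReflection (i : Fin 3) : Euc 3 ≃ₗᵢ[ℝ] Euc 3 :=
  LinearIsometryEquiv.piLpCongrRight 2 fun k =>
    if k = i then LinearIsometryEquiv.neg ℝ else LinearIsometryEquiv.refl ℝ ℝ

theorem coordReflection_apply_self (i : Fin 3) (z : Euc 3) : coordReflection i z i = -z i := by
  simp [coordReflection]

theorem coordReflection_apply_of_ne {i k : Fin 3} (h : k ≠ i) (z : Euc 3) :
    coordReflection i z k = z k := by
  simp [coordReflection, h]

theorem integral_coord_mul_coord_mul_exp_of_ne (b : Fin 3 → ℝ) {i j : Fin 3} (hij : i ≠ j) :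
    ∫ z : Euc 3, z i * z j * Real.exp (-∑ j, b j * z j ^ 2) * ‖z‖⁻¹ = 0 := by
  have h := (coordReflection i).measurePreserving.integral_comp
    (coordReflection i).toHomeomorph.measurableEmbedding
    (fun z : Euc 3 => z i * z j * Real.exp (-∑ j, b j * z j ^ 2) * ‖z‖⁻¹)
  have hsq : ∀ (z : Euc 3) k, coordReflection i z k ^ 2 = z k ^ 2 := by
    intro z k
    by_cases hk : k = i
    · rw [hk, coordReflection_apply_self, neg_sq]
    · rw [coordReflection_apply_of_ne hk]
  simp only [hsq, coordReflection_apply_self, coordReflection_apply_of_ne hij.symm,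
    LinearIsometryEquiv.norm_map, neg_mul, integral_neg] at h
  linarith

/-- Writing `‖z‖⁻¹` as a Gaussian integral and exchanging the order of integration. -/
theorem integral_mul_inv_norm_eq {f : Euc 3 → ℝ} (hf : Measurable f)
    (hint : Integrable fun z => f z * ‖z‖⁻¹) :
    ∫ z, f z * ‖z‖⁻¹ =
      2 / √Real.pi * ∫ u in Ioi (0 : ℝ), ∫ z, f z * Real.exp (-‖z‖ ^ 2 * u ^ 2) := by
  have hpi : 0 < √Real.pi := Real.sqrt_pos.2 Real.pi_pos
  have hg : ∀ z : Euc 3, ∫ u in Ioi (0 : ℝ), Real.exp (-‖z‖ ^ 2 * u ^ 2) =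
      √Real.pi / 2 * ‖z‖⁻¹ := by
    intro z
    rw [integral_gaussian_Ioi, Real.sqrt_div Real.pi_pos.le, Real.sqrt_sq (norm_nonneg z)]
    ring
  have hprod : Integrable (Function.uncurry fun (z : Euc 3) (u : ℝ) =>
      f z * Real.exp (-‖z‖ ^ 2 * u ^ 2)) (volume.prod (volume.restrict (Ioi 0))) := by
    rw [integrable_prod_iff (by fun_prop : Measurable _).aestronglyMeasurable]
    constructor
    · filter_upwards [Measure.ae_ne volume (0 : Euc 3)] with z hz
      have hz : 0 < ‖z‖ ^ 2 := by positivity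
      exact ((integrable_exp_neg_mul_sq hz).integrableOn).const_mul (f z)
    · refine (hint.norm.const_mul (√Real.pi / 2)).congr (ae_of_all _ fun z => ?_)
      simp only [Function.uncurry_apply_pair, norm_mul, Real.norm_eq_abs, Real.abs_exp, abs_inv,
        abs_norm, integral_const_mul, hg]
      ring
  rw [← integral_integral_swap hprod]
  simp only [integral_const_mul, hg]
  rw [← integral_const_mul]
  refine integral_congr_ae (ae_of_all _ fun z => ?_)
  field_simp

theorem integral_sq_mul_exp_neg_mul_sq {p : ℝ} (hp : 0 < p) :
    ∫ t : ℝ, t ^ 2 * Real.exp (-p * t ^ 2) = √(Real.pi / p) / (2 * p) := by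
  have hderiv : ∀ t : ℝ, HasDerivAt (fun t : ℝ => t * Real.exp (-p * t ^ 2))
      (Real.exp (-p * t ^ 2) - 2 * p * (t ^ 2 * Real.exp (-p * t ^ 2))) t := by
    intro t
    have h2 : HasDerivAt (fun r : ℝ => -p * r ^ 2) (-p * (2 * t)) t := by
      simpa using (hasDerivAt_pow 2 t).const_mul (-p)
    refine ((hasDerivAt_id t).mul h2.exp).congr_deriv ?_
    simp only [id]
    ring
  have hi1 := integrable_exp_neg_mul_sq hp
  have hi2 : Integrable fun t : ℝ => t ^ 2 * Real.exp (-p * t ^ 2) := by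
    simpa using integrable_rpow_mul_exp_neg_mul_sq hp (by norm_num : (-1 : ℝ) < (2 : ℕ))
  have h0 := integral_eq_zero_of_hasDerivAt_of_integrable hderiv (hi1.sub (hi2.const_mul (2 * p)))
    (integrable_mul_exp_neg_mul_sq hp)
  rw [integral_sub hi1 (hi2.const_mul _), integral_const_mul, integral_gaussian] at h0
  rw [eq_div_iff (by positivity)]
  linarith

theorem integral_sub_sq_mul_exp_neg_mul_sq {p : ℝ} (hp : 0 < p) (b : ℝ) :
    ∫ t : ℝ, (b - 2 * b ^ 2 * t ^ 2) * Real.exp (-p * t ^ 2) =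
      b * (p - b) / p * √(Real.pi / p) := by
  have hi1 := integrable_exp_neg_mul_sq hp
  have hi2 : Integrable fun t : ℝ => t ^ 2 * Real.exp (-p * t ^ 2) := by
    simpa using integrable_rpow_mul_exp_neg_mul_sq hp (by norm_num : (-1 : ℝ) < (2 : ℕ))
  simp only [sub_mul, mul_assoc (2 * b ^ 2)]
  rw [integral_sub (hi1.const_mul _) (hi2.const_mul _), integral_const_mul, integral_const_mul,
    integral_gaussian, integral_sq_mul_exp_neg_mul_sq hp]
  field_simp

theorem integral_coord_sub_sq_mul_gaussian {b : Fin 3 → ℝ} (hb : ∀ j, 0 < b j) (i : Fin 3)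
    (u : ℝ) :
    ∫ z : Euc 3, (b i - 2 * b i ^ 2 * z i ^ 2) * Real.exp (-∑ j, b j * z j ^ 2) *
        Real.exp (-‖z‖ ^ 2 * u ^ 2) =
      b i * u ^ 2 / (b i + u ^ 2) * ∏ k, √(Real.pi / (b k + u ^ 2)) := by
  have hpos : ∀ k, 0 < b k + u ^ 2 := fun k => add_pos_of_pos_of_nonneg (hb k) (sq_nonneg u)
  rw [← (PiLp.volume_preserving_toLp (Fin 3)).integral_comp
    (MeasurableEquiv.toLp 2 _).measurableEmbedding]
  have hpt : ∀ y : Fin 3 → ℝ, (b i - 2 * b i ^ 2 * (WithLp.toLp 2 y : Euc 3) i ^ 2) *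
      Real.exp (-∑ j, b j * (WithLp.toLp 2 y : Euc 3) j ^ 2) *
        Real.exp (-‖(WithLp.toLp 2 y : Euc 3)‖ ^ 2 * u ^ 2) =
      ∏ k, ((if k = i then b i - 2 * b i ^ 2 * y k ^ 2 else 1) *
        Real.exp (-(b k + u ^ 2) * y k ^ 2)) := by
    intro y
    rw [Finset.prod_mul_distrib, Finset.prod_ite_eq' Finset.univ i, if_pos (Finset.mem_univ i),
      ← Real.exp_sum, mul_assoc, ← Real.exp_add, EuclideanSpace.real_norm_sq_eq]
    simp only [Fin.sum_univ_three]
    congr 2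
    ring
  simp only [hpt]
  rw [integral_fintype_prod_volume_eq_prod (fun k (t : ℝ) =>
    (if k = i then b i - 2 * b i ^ 2 * t ^ 2 else 1) * Real.exp (-(b k + u ^ 2) * t ^ 2))]
  have hfac : ∀ k, ∫ t : ℝ, (if k = i then b i - 2 * b i ^ 2 * t ^ 2 else 1) *
      Real.exp (-(b k + u ^ 2) * t ^ 2) =
      (if k = i then b i * u ^ 2 / (b i + u ^ 2) else 1) * √(Real.pi / (b k + u ^ 2)) := by
    intro k
    by_cases hk : k = i
    · subst hk
      simp only [if_true]
      rw [integral_sub_sq_mul_exp_neg_mul_sq (hpos k), add_sub_cancel_left]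
    · simp only [if_neg hk, one_mul]
      exact integral_gaussian _
  simp only [hfac]
  rw [Finset.prod_mul_distrib, Finset.prod_ite_eq' Finset.univ i, if_pos (Finset.mem_univ i)]

theorem sqrt_pi_div_inv_sq_add_inv_sq {c r : ℝ} (hc : 0 < c) (hr : 0 < r) :
    √(Real.pi / ((c ^ 2)⁻¹ + r⁻¹ ^ 2)) = √Real.pi * (c * r) / √(c ^ 2 + r ^ 2) := by
  have h : Real.pi / ((c ^ 2)⁻¹ + r⁻¹ ^ 2) = Real.pi * (c * r) ^ 2 / (c ^ 2 + r ^ 2) := by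
    field_simp
    ring
  rw [h, Real.sqrt_div (by positivity), Real.sqrt_mul Real.pi_pos.le,
    Real.sqrt_sq (by positivity)]

/-- The Gaussian moments of `‖z‖⁻¹` give the classical elliptic integrals. -/
theorem integral_coord_sub_sq_mul_exp_mul_inv_norm {c : Fin 3 → ℝ} (hc : ∀ j, 0 < c j)
    (i : Fin 3) :
    ∫ z : Euc 3, (((c i) ^ 2)⁻¹ - 2 * ((c i) ^ 2)⁻¹ ^ 2 * z i ^ 2) *
        Real.exp (-∑ j, ((c j) ^ 2)⁻¹ * z j ^ 2) * ‖z‖⁻¹ =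
      2 * Real.pi * ((c 0 * c 1 * c 2 / 2) * ∫ s in Ioi (0 : ℝ),
        ((c i ^ 2 + s) * √((c 0 ^ 2 + s) * (c 1 ^ 2 + s) * (c 2 ^ 2 + s)))⁻¹) := by
  set b : Fin 3 → ℝ := fun j => ((c j) ^ 2)⁻¹ with hbdef
  have hb : ∀ j, 0 < b j := fun j => inv_pos.2 (pow_pos (hc j) 2)
  have hint : Integrable fun z : Euc 3 => (b i - 2 * b i ^ 2 * z i ^ 2) *
      Real.exp (-∑ j, b j * z j ^ 2) * ‖z‖⁻¹ := by
    refine (((integrable_exp_neg_mul_inv_norm hb).const_mul (b i)).sub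
      ((integrable_coord_mul_coord_mul_exp hb i i).const_mul (2 * b i ^ 2))).congr
      (ae_of_all _ fun z => ?_)
    simp only [Pi.sub_apply]
    ring
  rw [integral_mul_inv_norm_eq (by fun_prop) hint]
  simp only [integral_coord_sub_sq_mul_gaussian hb]
  rw [← integral_comp_rpow_Ioi _ (by norm_num : (-(1 / 2) : ℝ) ≠ 0), ← mul_assoc,
    ← integral_const_mul, ← integral_const_mul]
  refine setIntegral_congr_fun measurableSet_Ioi fun s hs => ?_
  obtain ⟨r, hr, rfl⟩ : ∃ r : ℝ, 0 < r ∧ r ^ 2 = s :=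
    ⟨√s, Real.sqrt_pos.2 hs, Real.sq_sqrt (le_of_lt hs)⟩
  have hp1 : (r ^ 2) ^ (-(1 / 2) : ℝ) = r⁻¹ := by
    rw [Real.rpow_neg (by positivity), ← Real.sqrt_eq_rpow, Real.sqrt_sq hr.le]
  have hp2 : (r ^ 2) ^ (-(1 / 2) - 1 : ℝ) = r⁻¹ ^ 3 := by
    rw [Real.rpow_sub (by positivity), hp1, Real.rpow_one]
    field_simp
  have habs : |(-(1 / 2) : ℝ)| = 1 / 2 := by norm_num
  simp only [hp1, hp2, habs, smul_eq_mul, Fin.prod_univ_three, hbdef,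
    sqrt_pi_div_inv_sq_add_inv_sq (hc _) hr]
  have h0 := hc 0
  have h1 := hc 1
  have h2 := hc 2
  have hi := hc i
  have hpi : √Real.pi ^ 2 = Real.pi := Real.sq_sqrt Real.pi_pos.le
  have hpi0 : 0 < √Real.pi := Real.sqrt_pos.2 Real.pi_pos
  rw [Real.sqrt_mul (by positivity), Real.sqrt_mul (by positivity)]
  have hs0 : 0 < √(c 0 ^ 2 + r ^ 2) := Real.sqrt_pos.2 (by positivity)
  have hs1 : 0 < √(c 1 ^ 2 + r ^ 2) := Real.sqrt_pos.2 (by positivity)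
  have hs2 : 0 < √(c 2 ^ 2 + r ^ 2) := Real.sqrt_pos.2 (by positivity)
  field_simp
  rw [hpi]
  ring

theorem integral_quadratic_mul_exp_mul_inv_norm {b : Fin 3 → ℝ} (hb : ∀ j, 0 < b j) (K : ℝ)
    (x : Euc 3) :
    ∫ z : Euc 3, (K + 2 * (∑ j, b j * x j * z j) ^ 2) * Real.exp (-∑ j, b j * z j ^ 2) * ‖z‖⁻¹ =
      K * (∫ z : Euc 3, Real.exp (-∑ j, b j * z j ^ 2) * ‖z‖⁻¹) + ∑ i, 2 * (b i * x i) ^ 2 *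
        ∫ z : Euc 3, z i * z i * Real.exp (-∑ j, b j * z j ^ 2) * ‖z‖⁻¹ := by
  have hpt : ∀ z : Euc 3, (K + 2 * (∑ j, b j * x j * z j) ^ 2) *
      Real.exp (-∑ j, b j * z j ^ 2) * ‖z‖⁻¹ =
      K * (Real.exp (-∑ j, b j * z j ^ 2) * ‖z‖⁻¹) + ∑ i, ∑ j, 2 * (b i * x i) * (b j * x j) *
        (z i * z j * Real.exp (-∑ j, b j * z j ^ 2) * ‖z‖⁻¹) := by
    intro z
    generalize Real.exp (-∑ j, b j * z j ^ 2) = w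
    simp only [Fin.sum_univ_three]
    ring
  have hI := integrable_coord_mul_coord_mul_exp hb
  simp only [hpt]
  rw [integral_add ((integrable_exp_neg_mul_inv_norm hb).const_mul K)
    (integrable_finsetSum _ fun i _ => integrable_finsetSum _ fun j _ => (hI i j).const_mul _),
    integral_const_mul, integral_finsetSum _ fun i _ =>
      integrable_finsetSum _ fun j _ => (hI i j).const_mul _]
  congr 1
  refine Finset.sum_congr rfl fun i _ => ?_
  rw [integral_finsetSum _ fun j _ => (hI i j).const_mul _, Finset.sum_eq_single i]
  · rw [integral_const_mul]
    ring
  · intro j _ hj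
    rw [integral_const_mul, integral_coord_mul_coord_mul_exp_of_ne b hj.symm, mul_zero]
  · simp

/-- Inside an ellipsoid with semiaxes `c₁, c₂, c₃`, the Newtonian potential is the
quadratic polynomial `C - (1/2)∑ aⱼ xⱼ²` with the classical coefficients `aⱼ`. -/
theorem newton_potential_of_ellipsoid (c : Fin 3 → ℝ) (hc : ∀ j, 0 < c j)
    (E : Set (Euc 3)) (hE : E = {x : Euc 3 | ∑ j, (x j) ^ 2 / (c j) ^ 2 < 1})
    (a : Fin 3 → ℝ)
    (ha : ∀ j, a j = (c 0 * c 1 * c 2 / 2) * ∫ s in Set.Ioi (0 : ℝ),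
      ((c j ^ 2 + s) * Real.sqrt ((c 0 ^ 2 + s) * (c 1 ^ 2 + s) * (c 2 ^ 2 + s)))⁻¹) :
    ∃ C : ℝ, ∀ x ∈ E, newtonPot E x = C - (1 / 2) * ∑ j, a j * (x j) ^ 2 := by
  have hmom := integral_coord_sub_sq_mul_exp_mul_inv_norm hc
  set b : Fin 3 → ℝ := fun j => ((c j) ^ 2)⁻¹ with hbdef
  have hb : ∀ j, 0 < b j := fun j => inv_pos.2 (pow_pos (hc j) 2)
  have hE' : E = {x : Euc 3 | ∑ j, b j * x j ^ 2 < 1} := by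
    simp only [hE, hbdef, div_eq_inv_mul]
  obtain ⟨m, hm⟩ : ∃ m : ℝ, ∫ z : Euc 3, Real.exp (-∑ j, b j * z j ^ 2) * ‖z‖⁻¹ = m := ⟨_, rfl⟩
  obtain ⟨M, hM⟩ : ∃ M : Fin 3 → ℝ, ∀ i,
      ∫ z : Euc 3, z i * z i * Real.exp (-∑ j, b j * z j ^ 2) * ‖z‖⁻¹ = M i := ⟨_, fun _ => rfl⟩
  have hcoef : ∀ i, b i * m - 2 * b i ^ 2 * M i = 2 * Real.pi * a i := by
    intro i
    rw [← hm, ← hM, ha i, ← hmom i, ← integral_const_mul, ← integral_const_mul, ← integral_sub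
      ((integrable_exp_neg_mul_inv_norm hb).const_mul _)
      ((integrable_coord_mul_coord_mul_exp hb i i).const_mul _)]
    refine integral_congr_ae (ae_of_all _ fun z => ?_)
    simp only [hbdef]
    ring
  refine ⟨1 / (4 * Real.pi) * m, fun x hx => ?_⟩
  rw [hE'] at hx
  rw [newtonPot, hE', integral_ellipsoid_inv_norm_sub hb hx,
    integral_quadratic_mul_exp_mul_inv_norm hb, hm]
  have h0 := hcoef 0
  have h1 := hcoef 1
  have h2 := hcoef 2
  have hpi := Real.pi_pos
  simp only [hM]
  simp only [Fin.sum_univ_three]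
  clear_value b
  field_simp
  linear_combination (-2 * x 0 ^ 2) * h0 - (2 * x 1 ^ 2) * h1 - (2 * x 2 ^ 2) * h2
end
end

section
/- Let Ω ⊂ ℂ be a nonempty bounded simply connected open set. Let f : ℂ ∖ Ω → ℂ be continuous, holomorphic on ℂ ∖ closure(Ω), and suppose there exist complex numbers α ≠ 0 and β such that f(z) - (αz + β) → 0 as |z| → ∞. If f(z) = i·Im(z) for every z in the boundary ∂Ω, then f is injective on ℂ ∖ closure(Ω). -/
open Filter
open Set Metric Topology

theorem dslope_symm {𝕜 E : Type*} [NontriviallyNormedField 𝕜] [NormedAddCommGroup E]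
    [NormedSpace 𝕜 E] (f : 𝕜 → E) (a b : 𝕜) : dslope f a b = dslope f b a := by
  rcases eq_or_ne a b with rfl | h
  · rfl
  · rw [dslope_of_ne f h.symm, dslope_of_ne f h, slope_comm]

theorem eq_of_dslope_eq_zero {𝕜 E : Type*} [NontriviallyNormedField 𝕜] [NormedAddCommGroup E]
    [NormedSpace 𝕜 E] {f : 𝕜 → E} {a b : 𝕜} (h : dslope f a b = 0) : f b = f a := by
  have := sub_smul_dslope f a b
  rw [h, smul_zero] at this
  exact (sub_eq_zero.1 this.symm)

/-- The divided difference of a holomorphic function is jointly continuous, also on the diagonal. -/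
theorem continuousOn_dslope_prod {f : ℂ → ℂ} {U : Set ℂ} (hU : IsOpen U)
    (hf : DifferentiableOn ℂ f U) :
    ContinuousOn (fun p : ℂ × ℂ => dslope f p.1 p.2) (U ×ˢ U) := by
  rintro ⟨a, b⟩ ⟨ha, hb⟩
  simp only at ha hb
  refine ContinuousAt.continuousWithinAt ?_
  have hfa : ContinuousAt f a := (hf.differentiableAt (hU.mem_nhds ha)).continuousAt
  have hfb : ContinuousAt f b := (hf.differentiableAt (hU.mem_nhds hb)).continuousAt
  rcases eq_or_ne a b with rfl | hab
  · have hstrict : HasStrictDerivAt f (deriv f a) a :=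
      (hf.analyticAt (hU.mem_nhds ha)).hasStrictDerivAt
    have hderiv : ContinuousAt (deriv f) a := (hf.analyticAt (hU.mem_nhds ha)).deriv.continuousAt
    rw [Metric.continuousAt_iff']
    intro ε hε
    have h1 := hstrict.isLittleO.def (half_pos hε)
    have h2 : ∀ᶠ p : ℂ × ℂ in 𝓝 (a, a), dist (deriv f p.1) (deriv f a) < ε :=
      (continuousAt_fst.tendsto (x := (a, a))).eventually (Metric.continuousAt_iff'.1 hderiv ε hε)
    filter_upwards [h1, h2] with p h1 h2
    obtain ⟨x, y⟩ := p
    simp only [dslope_same] at *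
    rcases eq_or_ne x y with rfl | hxy
    · simpa using h2
    · rw [dslope_symm, dslope_of_ne f hxy, slope_def_field, dist_eq_norm]
      have hxy' : x - y ≠ 0 := sub_ne_zero.2 hxy
      have : (f x - f y) / (x - y) - deriv f a
          = (f x - f y - (x - y) • deriv f a) / (x - y) := by
        rw [smul_eq_mul]; field_simp
      rw [this, norm_div, div_lt_iff₀ (norm_pos_iff.2 hxy')]
      have h1' : ‖f x - f y - (x - y) • deriv f a‖ ≤ ε / 2 * ‖x - y‖ := by
        simpa [ContinuousLinearMap.toSpanSingleton_apply] using h1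
      have := norm_pos_iff.2 hxy'
      nlinarith
  · have hne : ∀ᶠ p : ℂ × ℂ in 𝓝 (a, b), p.2 ≠ p.1 :=
      (isOpen_ne_fun continuous_snd continuous_fst).mem_nhds hab.symm
    have heq : (fun p : ℂ × ℂ => (f p.2 - f p.1) / (p.2 - p.1))
        =ᶠ[𝓝 (a, b)] fun p => dslope f p.1 p.2 := by
      filter_upwards [hne] with p hp
      rw [dslope_of_ne f hp, slope_def_field]
    refine ContinuousAt.congr ?_ heq
    refine ContinuousAt.div ?_ (by fun_prop) (sub_ne_zero.2 hab.symm)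
    exact (ContinuousAt.comp (f := Prod.snd) hfb continuousAt_snd).sub
      (ContinuousAt.comp (f := Prod.fst) hfa continuousAt_fst)

/-- A zero of a holomorphic function that is not locally zero persists under perturbation. -/
theorem eventually_exists_zero_of_continuousOn_prod {F : ℂ → ℂ → ℂ} {U : Set ℂ} (hU : IsOpen U)
    (hc : ContinuousOn (fun p : ℂ × ℂ => F p.1 p.2) (U ×ˢ U))
    (hd : ∀ a ∈ U, DifferentiableOn ℂ (F a) U) {a b : ℂ} (ha : a ∈ U) (hb : b ∈ U)
    (h0 : F a b = 0) (hnz : ¬ ∀ᶠ z in 𝓝 b, F a z = 0) :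
    ∀ᶠ a' in 𝓝 a, ∃ b' ∈ U, F a' b' = 0 := by
  have hcat : ∀ z ∈ U, ContinuousAt (fun p : ℂ × ℂ => F p.1 p.2) (a, z) := fun z hz =>
    hc.continuousAt ((hU.prod hU).mem_nhds ⟨ha, hz⟩)
  have hev : ∀ᶠ z in 𝓝[≠] b, F a z ≠ 0 :=
    (((hd a ha).analyticAt (hU.mem_nhds hb)).eventually_eq_zero_or_eventually_ne_zero).resolve_left
      hnz
  rw [eventually_nhdsWithin_iff] at hev
  obtain ⟨r, hr, hball⟩ := Metric.nhds_basis_closedBall.eventually_iff.1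
    (hev.and (hU.mem_nhds hb))
  have hsph : (sphere b r).Nonempty := NormedSpace.sphere_nonempty.2 hr.le
  have hsU : sphere b r ⊆ U := fun z hz => (hball (sphere_subset_closedBall hz)).2
  obtain ⟨z₀, hz₀, hmin⟩ := (isCompact_sphere b r).exists_isMinOn hsph
    (((hd a ha).continuousOn.mono hsU).norm)
  have hm : 0 < ‖F a z₀‖ := norm_pos_iff.2
    ((hball (sphere_subset_closedBall hz₀)).1 (ne_of_mem_sphere hz₀ hr.ne'))
  set m := ‖F a z₀‖
  have h1 : ∀ᶠ a' in 𝓝 a, ∀ z ∈ sphere b r, m / 2 < ‖F a' z‖ := by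
    refine (isCompact_sphere b r).eventually_forall_of_forall_eventually fun z hz => ?_
    have hmz : m ≤ ‖F a z‖ := hmin hz
    exact (hcat z (hsU hz)).norm.eventually (lt_mem_nhds (by simp only; linarith))
  have h2 : ∀ᶠ a' in 𝓝 a, ‖F a' b‖ < m / 2 := by
    have : ContinuousAt (fun a' => F a' b) a :=
      ContinuousAt.comp (f := fun a' => (a', b)) (hcat b hb) (by fun_prop)
    exact this.norm.eventually (gt_mem_nhds (by simp only [h0, norm_zero]; linarith))
  filter_upwards [h1, h2, hU.mem_nhds ha] with a' h1 h2 ha'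
  by_contra! hno
  have hsub : closedBall b r ⊆ U := fun z hz => (hball hz).2
  have hdiff : DiffContOnCl ℂ (fun z => (F a' z)⁻¹) (ball b r) := by
    refine DifferentiableOn.diffContOnCl ?_
    rw [closure_ball b hr.ne']
    exact ((hd a' ha').mono hsub).fun_inv fun z hz => hno z (hsub hz)
  have hle := Complex.norm_le_of_forall_mem_frontier_norm_le (C := (m / 2)⁻¹) isBounded_ball hdiff
    (fun z hz => by
      rw [frontier_ball b hr.ne'] at hz
      rw [norm_inv]
      exact inv_anti₀ (by linarith) (h1 z hz).le) (subset_closure (mem_ball_self hr))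
  rw [norm_inv] at hle
  have := (inv_le_inv₀ (norm_pos_iff.2 (hno b hb)) (by linarith)).1 hle
  linarith

theorem eventually_exists_dslope_eq_zero {f : ℂ → ℂ} {U : Set ℂ} (hU : IsOpen U)
    (hf : DifferentiableOn ℂ f U) (hnc : ∀ z ∈ U, ¬ ∀ᶠ w in 𝓝 z, f w = f z)
    {a b : ℂ} (ha : a ∈ U) (hb : b ∈ U) (h0 : dslope f a b = 0) :
    ∀ᶠ a' in 𝓝 a, ∃ b' ∈ U, dslope f a' b' = 0 := by
  refine eventually_exists_zero_of_continuousOn_prod hU (continuousOn_dslope_prod hU hf)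
    (fun a ha => (Complex.differentiableOn_dslope (hU.mem_nhds ha)).2 hf) ha hb h0 fun h => ?_
  refine hnc b hb (h.mono fun w hw => ?_)
  rw [eq_of_dslope_eq_zero hw, eq_of_dslope_eq_zero h0]

/-- If a holomorphic map is proper over a connected open set and is injective and unramified over
one of its points, then it is injective and unramified over the whole set. -/
theorem dslope_ne_zero_of_isCompact_preimage {f : ℂ → ℂ} {U H : Set ℂ} (hU : IsOpen U)
    (hf : DifferentiableOn ℂ f U) (hnc : ∀ z ∈ U, ¬ ∀ᶠ w in 𝓝 z, f w = f z)
    (hH : IsOpen H) (hHc : IsPreconnected H)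
    (hproper : ∀ K ⊆ H, IsCompact K → IsCompact (U ∩ f ⁻¹' K))
    {w₀ : ℂ} (hw₀ : w₀ ∈ H) (hinj : ∀ a ∈ U, ∀ b ∈ U, f a = w₀ → dslope f a b ≠ 0)
    {a b : ℂ} (ha : a ∈ U) (hb : b ∈ U) (hfa : f a ∈ H) : dslope f a b ≠ 0 := by
  intro hab
  set A : Set ℂ := H ∩ {w | ∃ a ∈ U, f a = w ∧ ∃ b ∈ U, dslope f a b = 0}
  have hAo : IsOpen A := by
    rw [isOpen_iff_mem_nhds]
    rintro _ ⟨hwH, a, ha, rfl, b, hb, h0⟩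
    refine inter_mem (hH.mem_nhds hwH) ?_
    refine ((hf.analyticAt
      (hU.mem_nhds ha)).eventually_constant_or_nhds_le_map_nhds.resolve_left (hnc a ha)) ?_
    rw [mem_map]
    filter_upwards [eventually_exists_dslope_eq_zero hU hf hnc ha hb h0, hU.mem_nhds ha]
      with a' h ha'
    exact ⟨a', ha', rfl, h⟩
  have hAcl : closure A ∩ H ⊆ A := by
    rintro w ⟨hwA, hwH⟩
    obtain ⟨K, hKw, hKH, hK⟩ := local_compact_nhds (hH.mem_nhds hwH)
    have hC := hproper K hKH hK
    set C := U ∩ f ⁻¹' K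
    have hCU : C ⊆ U := inter_subset_left
    have hD : IsCompact ((C ×ˢ C) ∩ (fun p : ℂ × ℂ => dslope f p.1 p.2) ⁻¹' {0}) :=
      (hC.prod hC).of_isClosed_subset
        (((continuousOn_dslope_prod hU hf).mono (prod_mono hCU hCU)).preimage_isClosed_of_isClosed
          (hC.prod hC).isClosed isClosed_singleton) inter_subset_left
    have hI := hD.image_of_continuousOn (f := fun p => f p.1)
      (hf.continuousOn.comp (f := Prod.fst) continuousOn_fst fun p hp => hCU hp.1.1)
    have hsub : A ∩ K ⊆ (fun p : ℂ × ℂ => f p.1) ''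
        ((C ×ˢ C) ∩ (fun p : ℂ × ℂ => dslope f p.1 p.2) ⁻¹' {0}) := by
      rintro _ ⟨⟨-, a, ha, rfl, b, hb, h0⟩, hwK⟩
      refine ⟨(a, b), ⟨⟨⟨ha, hwK⟩, ⟨hb, ?_⟩⟩, h0⟩, rfl⟩
      rw [mem_preimage, eq_of_dslope_eq_zero h0]
      exact hwK
    have hwAK : w ∈ closure (A ∩ K) := by
      rw [mem_closure_iff_nhds] at hwA ⊢
      intro t ht
      obtain ⟨x, ⟨hxt, hxK⟩, hxA⟩ := hwA (t ∩ K) (inter_mem ht hKw)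
      exact ⟨x, hxt, hxA, hxK⟩
    obtain ⟨⟨a, b⟩, ⟨⟨ha, hb⟩, h0⟩, hfa⟩ := closure_minimal hsub hI.isClosed hwAK
    exact ⟨hwH, a, hCU ha, hfa, b, hCU hb, h0⟩
  obtain ⟨-, x, hx, hfx, y, hy, h0⟩ := hHc.subset_of_closure_inter_subset hAo
    ⟨f a, hfa, hfa, a, ha, rfl, b, hb, hab⟩ hAcl hw₀
  exact hinj x hx y hy hfx h0

/-- A function asymptotic to an affine function with nonzero slope is injective and unramified near
infinity. -/
theorem exists_dslope_ne_zero_of_tendsto {f : ℂ → ℂ} {α β : ℂ} (hα : α ≠ 0)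
    (hasym : Tendsto (fun z => f z - (α * z + β)) (cocompact ℂ) (𝓝 0))
    (hf : ∀ᶠ z in cocompact ℂ, DifferentiableAt ℂ f z) :
    ∃ R : ℝ, ∀ a b : ℂ, R < ‖a‖ → R < ‖b‖ → dslope f a b ≠ 0 := by
  set g : ℂ → ℂ := fun z => f z - (α * z + β) with hg
  have hα' : 0 < ‖α‖ := norm_pos_iff.2 hα
  have hev : ∀ᶠ z in cocompact ℂ, ‖g z‖ < ‖α‖ / 4 ∧ DifferentiableAt ℂ f z :=
    (hasym.norm.eventually (gt_mem_nhds (by rw [norm_zero]; positivity))).and hf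
  rw [← comap_norm_atTop.trans Metric.cobounded_eq_cocompact, eventually_comap] at hev
  obtain ⟨R, hR⟩ := eventually_atTop.1 hev
  have hgR : ∀ z : ℂ, R ≤ ‖z‖ → ‖g z‖ < ‖α‖ / 4 := fun z hz => (hR _ hz z rfl).1
  have hlin : ∀ z, HasDerivAt (fun z : ℂ => α * z + β) α z := fun z => by
    simpa using ((hasDerivAt_id z).const_mul α).add_const β
  have hfd : ∀ z : ℂ, R ≤ ‖z‖ → DifferentiableAt ℂ f z := fun z hz => (hR _ hz z rfl).2
  have hgd : ∀ z : ℂ, R ≤ ‖z‖ → DifferentiableAt ℂ g z := fun z hz =>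
    (hfd z hz).sub (hlin z).differentiableAt
  have hfar : ∀ x y : ℂ, ∀ s : ℝ, s + 1 ≤ ‖x‖ → dist y x ≤ 1 → s ≤ ‖y‖ := fun x y s hx hy => by
    have := norm_sub_norm_le x y
    rw [dist_comm, dist_eq_norm] at hy
    linarith
  have hderiv : ∀ z : ℂ, R + 1 ≤ ‖z‖ → ‖deriv g z‖ ≤ ‖α‖ / 4 := fun z hz => by
    have := Complex.norm_deriv_le_of_forall_mem_sphere_norm_le (c := z) (R := 1) (C := ‖α‖ / 4)
      (f := g) one_pos
      (DifferentiableOn.diffContOnCl (by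
        rw [closure_ball z one_ne_zero]
        exact fun y hy => (hgd y (hfar z y R hz hy)).differentiableWithinAt))
      (fun y hy => (hgR y (hfar z y R hz (mem_sphere.1 hy).le)).le)
    simpa using this
  refine ⟨R + 2, fun a b ha hb h0 => ?_⟩
  rcases eq_or_ne a b with rfl | hab
  · rw [dslope_same] at h0
    have h1 : deriv g a = deriv f a - α := by
      rw [← (hlin a).deriv]
      exact deriv_sub (hfd a (by linarith)) (hlin a).differentiableAt
    have h2 := hderiv a (by linarith)
    rw [h1, h0, zero_sub, norm_neg] at h2
    linarith
  · have hpos : 0 < ‖b - a‖ := norm_pos_iff.2 (sub_ne_zero.2 hab.symm)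
    have h1 : ‖g b - g a‖ = ‖α‖ * ‖b - a‖ := by
      have : g b - g a = -(α * (b - a)) := by
        simp only [hg, eq_of_dslope_eq_zero h0]; ring
      rw [this, norm_neg, norm_mul]
    have h2 : ‖g b - g a‖ ≤ ‖α‖ / 2 * ‖b - a‖ := by
      rcases lt_or_ge ‖b - a‖ 1 with hlt | hge
      · have := (convex_ball a 1).norm_image_sub_le_of_norm_deriv_le (f := g) (C := ‖α‖ / 4)
          (fun y hy => hgd y (hfar a y R (by linarith) (mem_ball.1 hy).le))
          (fun y hy => hderiv y (hfar a y (R + 1) (by linarith) (mem_ball.1 hy).le))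
          (mem_ball_self one_pos) (mem_ball.2 (by rwa [dist_eq_norm]) : b ∈ ball a 1)
        nlinarith
      · have := norm_sub_le (g b) (g a)
        have := hgR a (by linarith)
        have := hgR b (by linarith)
        nlinarith
    nlinarith

/-- A nonempty open bounded subset of the plane has frontier points at different heights. -/
theorem not_forall_frontier_im_eq {V : Set ℂ} (hV : IsOpen V) (hb : Bornology.IsBounded V)
    (hne : V.Nonempty) (t : ℝ) : ¬ ∀ z ∈ frontier V, z.im = t := by
  intro h
  have hnotmax : ∀ z ∈ V, ∃ y ∈ V, |z.im - t| < |y.im - t| := by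
    intro z hz
    obtain ⟨ε, hε, hball⟩ := Metric.isOpen_iff.1 hV z hz
    have hmem : ∀ s : ℝ, |s| < ε → z + s * Complex.I ∈ V := fun s hs =>
      hball (by simpa [dist_eq_norm] using hs)
    rcases le_total 0 (z.im - t) with h0 | h0
    · refine ⟨_, hmem (ε / 2) (by rw [abs_of_pos] <;> linarith), ?_⟩
      simp only [Complex.add_im, Complex.mul_im, Complex.ofReal_re, Complex.I_im, Complex.ofReal_im,
        Complex.I_re]
      rw [abs_of_nonneg h0, abs_of_nonneg] <;> linarith
    · refine ⟨_, hmem (-(ε / 2)) (by rw [abs_of_neg] <;> linarith), ?_⟩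
      simp only [Complex.add_im, Complex.mul_im, Complex.ofReal_re, Complex.I_im, Complex.ofReal_im,
        Complex.I_re]
      rw [abs_of_nonpos h0, abs_of_nonpos] <;> linarith
  obtain ⟨m, hm, hmax⟩ := hb.isCompact_closure.exists_isMaxOn hne.closure
    (f := fun z : ℂ => |z.im - t|) (by fun_prop)
  by_cases hmV : m ∈ V
  · obtain ⟨y, hy, hlt⟩ := hnotmax m hmV
    exact (hmax (subset_closure hy)).not_gt hlt
  · have hm0 : m.im = t := h m ⟨hm, by rwa [hV.interior_eq]⟩
    obtain ⟨z, hz⟩ := hne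
    obtain ⟨y, hy, hlt⟩ := hnotmax z hz
    have hy' : |y.im - t| ≤ |m.im - t| := hmax (subset_closure hy)
    rw [hm0, sub_self, abs_zero] at hy'
    linarith [abs_nonneg (z.im - t)]

theorem tendsto_norm_atTop_of_tendsto_sub_affine {f : ℂ → ℂ} {α β : ℂ} (hα : α ≠ 0)
    (hasym : Tendsto (fun z => f z - (α * z + β)) (cocompact ℂ) (𝓝 0)) :
    Tendsto (fun z => ‖f z‖) (cocompact ℂ) atTop := by
  have h1 : Tendsto (fun z : ℂ => ‖α‖ * ‖z‖ - (‖β‖ + 1)) (cocompact ℂ) atTop :=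
    tendsto_atTop_add_const_right _ _
      ((tendsto_norm_cocompact_atTop (E := ℂ)).const_mul_atTop (norm_pos_iff.2 hα))
  refine tendsto_atTop_mono' _ ?_ h1
  have hone : ‖(0 : ℂ)‖ < 1 := by simp
  filter_upwards [hasym.norm.eventually (gt_mem_nhds hone)] with z hz
  have e : α * z = f z - (f z - (α * z + β)) - β := by ring
  have h3 := norm_sub_le (f z - (f z - (α * z + β))) β
  have h4 := norm_sub_le (f z) (f z - (α * z + β))
  rw [← e, norm_mul] at h3
  linarith

theorem isBounded_setOf_norm_le {f : ℂ → ℂ}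
    (hinf : Tendsto (fun z => ‖f z‖) (cocompact ℂ) atTop) (M : ℝ) :
    Bornology.IsBounded {z | ‖f z‖ ≤ M} := by
  rw [← Bornology.isCobounded_compl_iff, Bornology.isCobounded_def, Metric.cobounded_eq_cocompact]
  filter_upwards [hinf.eventually (eventually_gt_atTop M)] with z hz
  exact hz.not_ge

theorem isPreconnected_setOf_re_pos : IsPreconnected {z : ℂ | 0 < z.re} :=
  (convex_halfSpace_re_gt 0).isPreconnected

theorem isPreconnected_setOf_re_neg : IsPreconnected {z : ℂ | z.re < 0} :=
  (convex_halfSpace_re_lt 0).isPreconnected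

/-- Identity theorem: a function whose boundary values are `i·Im z` and which tends to infinity
is nowhere locally constant. -/
theorem not_eventually_const_of_frontier {Ω : Set ℂ} (hop : IsOpen Ω) {f : ℂ → ℂ}
    (hcont : ContinuousOn f Ωᶜ) (hhol : DifferentiableOn ℂ f (closure Ω)ᶜ)
    (hinf : Tendsto (fun z => ‖f z‖) (cocompact ℂ) atTop)
    (hbdry : ∀ z ∈ frontier Ω, f z = Complex.I * (z.im : ℂ)) :
    ∀ z ∈ (closure Ω)ᶜ, ¬ ∀ᶠ w in 𝓝 z, f w = f z := by
  intro z₀ hz₀ hconst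
  set c := f z₀
  have hUo : IsOpen (closure Ω)ᶜ := isClosed_closure.isOpen_compl
  have hUsub : (closure Ω)ᶜ ⊆ Ωᶜ := compl_subset_compl.2 subset_closure
  set V : Set ℂ := (closure Ω)ᶜ ∩ {z | ∀ᶠ w in 𝓝 z, f w = c}
  have hVo : IsOpen V := hUo.inter isOpen_setOfPred_eventually_nhds
  have hVc : ∀ z ∈ V, f z = c := fun z hz => hz.2.self_of_nhds
  have hVcl : closure V ⊆ Ωᶜ :=
    closure_minimal (inter_subset_left.trans hUsub) hop.isClosed_compl
  have hVb : Bornology.IsBounded V :=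
    (isBounded_setOf_norm_le hinf ‖c‖).subset fun z hz => (congrArg norm (hVc z hz)).le
  refine not_forall_frontier_im_eq hVo hVb ⟨z₀, hz₀, hconst⟩ c.im fun z hz => ?_
  have hzcl : z ∈ closure V := hz.1
  have hzV : z ∉ V := by simpa [hVo.interior_eq] using hz.2
  have hzc : f z = c := by
    have hclosed : IsClosed (Ωᶜ ∩ f ⁻¹' {c}) :=
      hcont.preimage_isClosed_of_isClosed hop.isClosed_compl isClosed_singleton
    have hsub : V ⊆ Ωᶜ ∩ f ⁻¹' {c} := fun y hy => ⟨hUsub hy.1, hVc y hy⟩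
    exact (closure_minimal hsub hclosed hzcl).2
  have hzfr : z ∈ frontier Ω := by
    refine ⟨by_contra fun hzU => hzV ⟨hzU, ?_⟩, by rw [hop.interior_eq]; exact hVcl hzcl⟩
    have han : AnalyticAt ℂ f z := hhol.analyticAt (hUo.mem_nhds hzU)
    refine (han.frequently_eq_iff_eventually_eq analyticAt_const).1 ?_
    have hfreq : ∃ᶠ y in 𝓝 z, y ∈ V := mem_closure_iff_frequently.1 hzcl
    rw [frequently_nhdsWithin_iff]
    exact hfreq.mono fun y hy => ⟨hVc y hy, fun h => hzV (h ▸ hy)⟩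
  have := congrArg Complex.im ((hbdry z hzfr).symm.trans hzc)
  simpa using this

/-- Univalence of the exterior map: if `f` is continuous on `ℂ ∖ Ω`, holomorphic outside
`closure Ω`, behaves like `αz + β` (with `α ≠ 0`) at infinity and equals `i·Im z` on the
boundary of `Ω`, then `f` is injective on `ℂ ∖ closure Ω`. -/
theorem exterior_map_injective (Ω : Set ℂ) (hne : Ω.Nonempty)
    (hbd : Bornology.IsBounded Ω) (hop : IsOpen Ω) (hsc : SimplyConnectedSpace Ω)
    (f : ℂ → ℂ) (hcont : ContinuousOn f Ωᶜ) (hhol : DifferentiableOn ℂ f (closure Ω)ᶜ)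
    (α β : ℂ) (hα : α ≠ 0)
    (hasym : Tendsto (fun z => f z - (α * z + β)) (cocompact ℂ) (nhds 0))
    (hbdry : ∀ z ∈ frontier Ω, f z = Complex.I * (z.im : ℂ)) :
    Set.InjOn f (closure Ω)ᶜ := by
  have hUo : IsOpen (closure Ω)ᶜ := isClosed_closure.isOpen_compl
  have hinf := tendsto_norm_atTop_of_tendsto_sub_affine hα hasym
  have hnc := not_eventually_const_of_frontier hop hcont hhol hinf hbdry
  have hmem : ∀ z ∈ Ωᶜ, (f z).re ≠ 0 → z ∈ (closure Ω)ᶜ := fun z hz hre hzcl => hre <| by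
    simp [hbdry z ⟨hzcl, by rwa [hop.interior_eq]⟩]
  have hUsub : (closure Ω)ᶜ ⊆ Ωᶜ := compl_subset_compl.2 subset_closure
  have hproper : ∀ K ⊆ {z : ℂ | z.re ≠ 0}, IsCompact K → IsCompact ((closure Ω)ᶜ ∩ f ⁻¹' K) := by
    intro K hK hKc
    have heq : (closure Ω)ᶜ ∩ f ⁻¹' K = Ωᶜ ∩ f ⁻¹' K :=
      Subset.antisymm (inter_subset_inter_left _ hUsub)
        fun z hz => ⟨hmem z hz.1 (hK hz.2), hz.2⟩
    rw [heq]
    refine Metric.isCompact_of_isClosed_isBounded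
      (hcont.preimage_isClosed_of_isClosed hop.isClosed_compl hKc.isClosed) ?_
    obtain ⟨M, hM⟩ := hKc.isBounded.exists_norm_le
    exact (isBounded_setOf_norm_le hinf M).subset fun z hz => hM _ hz.2
  obtain ⟨R, hR⟩ := exists_dslope_ne_zero_of_tendsto hα hasym (by
    filter_upwards [hbd.isCompact_closure.compl_mem_cocompact] with z hz
    exact hhol.differentiableAt (hUo.mem_nhds hz))
  obtain ⟨M, hM⟩ := (((isCompact_closedBall (0 : ℂ) R).inter_left
    hop.isClosed_compl).image_of_continuousOn (hcont.mono inter_subset_left)).isBounded.exists_norm_le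
  have hlarge : ∀ w : ℂ, M < ‖w‖ → ∀ a ∈ (closure Ω)ᶜ, ∀ b ∈ (closure Ω)ᶜ, f a = w →
      dslope f a b ≠ 0 := by
    intro w hw a ha b hb hfa h0
    have hbig : ∀ z ∈ (closure Ω)ᶜ, f z = w → R < ‖z‖ := fun z hz hfz => by
      by_contra! hle
      have := hM (f z) ⟨z, ⟨hUsub hz, by simpa using hle⟩, rfl⟩
      rw [hfz] at this
      linarith
    exact hR a b (hbig a ha hfa) (hbig b hb ((eq_of_dslope_eq_zero h0).trans hfa)) h0
  have hoff : ∀ a ∈ (closure Ω)ᶜ, ∀ b ∈ (closure Ω)ᶜ, (f a).re ≠ 0 → dslope f a b ≠ 0 := by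
    intro a ha b hb hre
    have hnorm : ∀ s : ℝ, |s| = |M| + 1 → M < ‖(s : ℂ)‖ := fun s hs => by
      rw [Complex.norm_real, Real.norm_eq_abs, hs]
      linarith [le_abs_self M]
    have hpos : 0 < |M| + 1 := by positivity
    rcases hre.lt_or_gt with hlt | hgt
    · refine dslope_ne_zero_of_isCompact_preimage hUo hhol hnc
        (isOpen_lt Complex.continuous_re continuous_const) isPreconnected_setOf_re_neg
        (fun K hK => hproper K fun z hz => (hK hz).ne) (w₀ := ((-(|M| + 1) : ℝ) : ℂ)) ?_
        (hlarge _ (hnorm _ (by rw [abs_neg, abs_of_pos hpos]))) ha hb hlt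
      rw [mem_ofPred_eq, Complex.ofReal_re]
      linarith
    · refine dslope_ne_zero_of_isCompact_preimage hUo hhol hnc
        (isOpen_lt continuous_const Complex.continuous_re) isPreconnected_setOf_re_pos
        (fun K hK => hproper K fun z hz => (hK hz).ne') (w₀ := ((|M| + 1 : ℝ) : ℂ)) ?_
        (hlarge _ (hnorm _ (abs_of_pos hpos))) ha hb hgt
      rwa [mem_ofPred_eq, Complex.ofReal_re]
  intro a ha b hb hab
  by_contra hne
  have h0 : dslope f a b = 0 := by
    rw [dslope_of_ne f (Ne.symm hne), slope_def_field, hab, sub_self, zero_div]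
  have hev := eventually_exists_dslope_eq_zero hUo hhol hnc ha hb h0
  have hre : ∀ᶠ w in 𝓝 (f a), w.re = 0 :=
    ((hhol.analyticAt (hUo.mem_nhds ha)).eventually_constant_or_nhds_le_map_nhds.resolve_left
      (hnc a ha)) (by
        rw [mem_map]
        filter_upwards [hev, hUo.mem_nhds ha] with a' h ha'
        obtain ⟨b', hb', h0'⟩ := h
        exact by_contra fun h => hoff a' ha' b' hb' h h0')
  obtain ⟨ε, hε, hball⟩ := Metric.eventually_nhds_iff_ball.1 hre
  have h1 := hball (f a) (mem_ball_self hε)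
  have h2 := hball (f a + ((ε / 2 : ℝ) : ℂ)) (by
    rw [mem_ball, dist_eq_norm, add_sub_cancel_left, Complex.norm_real, Real.norm_eq_abs,
      abs_of_pos] <;> linarith)
  rw [Complex.add_re, h1, Complex.ofReal_re] at h2
  linarith
end
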